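/- Let K ⊆ ℂ be a subfield and let Q₀ ∈ K^×. Then the set {(A,B) ∈ W_N^{top,0}(K) : λ(A,B) = Q₀} is nonempty and L_N(K) acts transitively on it, and the stabilizer in L_N(K) of any element of this set is trivial. -/

import Mathlib

open Matrix MvPolynomial

/-- Pairs of `N × N` matrices over `R`, with `N = 2n+1`. -/
abbrev MPair (n : ℕ) (R : Type*) : Type _ :=
  Matrix (Fin (2*n+1)) (Fin (2*n+1)) R × Matrix (Fin (2*n+1)) (Fin (2*n+1)) R

/-- The action of a matrix `g` on a pair: `g • (A, B) = (g A gᵀ, g B gᵀ)`. -/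
def actPair {R : Type*} [CommRing R] {m : ℕ} (g : Matrix (Fin m) (Fin m) R)
    (w : Matrix (Fin m) (Fin m) R × Matrix (Fin m) (Fin m) R) :
    Matrix (Fin m) (Fin m) R × Matrix (Fin m) (Fin m) R :=
  (g * w.1 * g.transpose, g * w.2 * g.transpose)

/-- Membership in `W_N(R)`: both matrices are symmetric. -/
def WNmem {R : Type*} [CommRing R] (n : ℕ) (w : MPair n R) : Prop := w.1.IsSymm ∧ w.2.IsSymm

/-- The inclusion `Fin n → Fin (2n+1)` of the first `n` indices. -/
def rowIdx (n : ℕ) (i : Fin n) : Fin (2*n+1) := Fin.castLE (by omega) i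

/-- The inclusion `Fin (n+1) → Fin (2n+1)` of the last `n+1` indices. -/
def colIdx (n : ℕ) (j : Fin (n+1)) : Fin (2*n+1) :=
  Fin.cast (by omega) (Fin.natAdd n j)

/-- The coefficient of `x^{N-i} y^i` in a binary `N`-ic form (written in
`MvPolynomial (Fin 2) R`, where variable `0` is `x` and variable `1` is `y`). -/
noncomputable def formCoeff {R : Type*} [CommRing R] (f : MvPolynomial (Fin 2) R) (N i : ℕ) : R :=
  MvPolynomial.coeff (Finsupp.single (0 : Fin 2) (N - i) + Finsupp.single (1 : Fin 2) i) f

/-- The `λ`-invariant of a pair `(A,B)`, computed from the top-right `n × (n+1)` blocks: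
the determinant of the `(n+1) × (n+1)` matrix whose `(i,j)` entry (0-indexed) is `(-1)^i`
times the coefficient of `x^{n-j} y^j` in `det(x A^{(i)} - y B^{(i)})`, where `A^{(i)}`,
`B^{(i)}` are obtained from the top-right `n × (n+1)` blocks by deleting the `i`-th column. -/
noncomputable def lambdaInv {R : Type*} [CommRing R] (n : ℕ) (w : MPair n R) : R :=
  Matrix.det (Matrix.of fun i j : Fin (n+1) =>
    (-1 : R) ^ (i : ℕ) *
      formCoeff
        (Matrix.det (Matrix.of fun r c : Fin n =>
          MvPolynomial.X 0 * MvPolynomial.C (w.1 (rowIdx n r) (colIdx n (i.succAbove c))) -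
          MvPolynomial.X 1 * MvPolynomial.C (w.2 (rowIdx n r) (colIdx n (i.succAbove c)))))
        n (j : ℕ))
/-- Membership in `W_N^top(R)`: symmetric pairs vanishing on the top-left `n × n` and
bottom-right `(n+1) × (n+1)` blocks. -/
def Wtopmem {R : Type*} [CommRing R] (n : ℕ) (w : MPair n R) : Prop :=
  WNmem n w ∧ ∀ i j : Fin (2*n+1),
    (((i : ℕ) < n ∧ (j : ℕ) < n) ∨ (n ≤ (i : ℕ) ∧ n ≤ (j : ℕ))) → w.1 i j = 0 ∧ w.2 i j = 0

/-- Membership in the block-diagonal subgroup `(SL_n × SL_{n+1})(R) ⊆ SL_N(R)`. -/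
def SLnn1mem {R : Type*} [CommRing R] (n : ℕ) (g : Matrix (Fin (2*n+1)) (Fin (2*n+1)) R) :
    Prop :=
  (∀ i j : Fin (2*n+1),
      (((i : ℕ) < n ∧ n ≤ (j : ℕ)) ∨ (n ≤ (i : ℕ) ∧ (j : ℕ) < n)) → g i j = 0) ∧
  Matrix.det (Matrix.of fun i j : Fin n => g (rowIdx n i) (rowIdx n j)) = 1 ∧
  Matrix.det (Matrix.of fun i j : Fin (n+1) => g (colIdx n i) (colIdx n j)) = 1
/-- Membership in `W_N^{top,0}(R)`: elements of `W_N^top(R)` with (1-indexed) `A_{ij} = 0`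
for `i + j ≤ 2n+1` and `B_{ij} = 0` for `i + j ≤ 2n`. -/
def Wtop0mem {R : Type*} [CommRing R] (n : ℕ) (w : MPair n R) : Prop :=
  Wtopmem n w ∧ ∀ i j : Fin (2*n+1),
    (((i : ℕ) + 1) + ((j : ℕ) + 1) ≤ 2*n+1 → w.1 i j = 0) ∧
    (((i : ℕ) + 1) + ((j : ℕ) + 1) ≤ 2*n → w.2 i j = 0)

/-- Membership in the lower-triangular subgroup `L_N(R) ⊆ (SL_n × SL_{n+1})(R)`. -/
def LNmem {R : Type*} [CommRing R] (n : ℕ) (g : Matrix (Fin (2*n+1)) (Fin (2*n+1)) R) : Prop :=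
  SLnn1mem n g ∧ ∀ i j : Fin (2*n+1), (i : ℕ) < (j : ℕ) → g i j = 0

/-- The matrix of signed coefficients of the maximal minors of the pencil `x a - y b`. -/
noncomputable def pencilMinors {R : Type*} [CommRing R] {n : ℕ}
    (a b : Matrix (Fin n) (Fin (n+1)) R) : Matrix (Fin (n+1)) (Fin (n+1)) R :=
  Matrix.of fun i j : Fin (n+1) =>
    (-1 : R) ^ (i : ℕ) *
      formCoeff
        (Matrix.det (Matrix.of fun r c : Fin n =>
          MvPolynomial.X 0 * MvPolynomial.C (a r (i.succAbove c)) -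
          MvPolynomial.X 1 * MvPolynomial.C (b r (i.succAbove c))))
        n (j : ℕ)

section CommRing

variable {R : Type*} [CommRing R] {n : ℕ}

/-- The vector of signed maximal minors of an `n × (n+1)` matrix lies in its kernel. -/
lemma sum_mul_signed_minor_eq_zero (M : Matrix (Fin n) (Fin (n+1)) R) (r : Fin n) :
    ∑ c : Fin (n+1), M r c * ((-1) ^ (c : ℕ) * det (M.submatrix id c.succAbove)) = 0 := by
  have h : det (Matrix.of (Fin.cons (M r) M) : Matrix (Fin (n+1)) (Fin (n+1)) R) = 0 :=
    det_zero_of_row_eq (Fin.succ_ne_zero r).symm rfl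
  rw [det_succ_row_zero] at h
  rw [← h]
  refine Finset.sum_congr rfl fun c _ => ?_
  have : (Matrix.of (Fin.cons (M r) M) : Matrix (Fin (n+1)) (Fin (n+1)) R).submatrix
      Fin.succ c.succAbove = M.submatrix id c.succAbove := rfl
  rw [this, show (Matrix.of (Fin.cons (M r) M) : Matrix (Fin (n+1)) (Fin (n+1)) R) 0 c = M r c
    from rfl]
  ring

lemma formCoeff_X_zero_mul (f : MvPolynomial (Fin 2) R) (m j : ℕ) (hj : j ≤ m) :
    formCoeff (X 0 * f) (m+1) j = formCoeff f m j := by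
  unfold formCoeff
  rw [show m + 1 - j = 1 + (m - j) by omega, Finsupp.single_add, add_assoc, coeff_X_mul]

lemma formCoeff_X_zero_mul_top (f : MvPolynomial (Fin 2) R) (m : ℕ) :
    formCoeff (X 0 * f) m m = 0 := by
  unfold formCoeff
  rw [coeff_X_mul', if_neg]
  simp

lemma formCoeff_X_one_mul (f : MvPolynomial (Fin 2) R) (m j : ℕ) :
    formCoeff (X 1 * f) (m+1) (j+1) = formCoeff f m j := by
  unfold formCoeff
  rw [show m + 1 - (j + 1) = m - j by omega, add_comm j 1, Finsupp.single_add,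
    add_left_comm, coeff_X_mul]

lemma formCoeff_X_one_mul_zero (f : MvPolynomial (Fin 2) R) (m : ℕ) :
    formCoeff (X 1 * f) m 0 = 0 := by
  unfold formCoeff
  rw [coeff_X_mul', if_neg]
  simp

lemma pencil_relation (a b : Matrix (Fin n) (Fin (n+1)) R) (r : Fin n) (m j : ℕ) :
    ∑ c : Fin (n+1), (a r c * ((-1) ^ (c : ℕ) * formCoeff (X 0 *
      (Matrix.det (Matrix.of fun r' c' : Fin n =>
          (X 0 : MvPolynomial (Fin 2) R) * C (a r' (c.succAbove c')) -
          X 1 * C (b r' (c.succAbove c'))))) m j)) =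
    ∑ c : Fin (n+1), (b r c * ((-1) ^ (c : ℕ) * formCoeff (X 1 *
      (Matrix.det (Matrix.of fun r' c' : Fin n =>
          (X 0 : MvPolynomial (Fin 2) R) * C (a r' (c.succAbove c')) -
          X 1 * C (b r' (c.succAbove c'))))) m j)) := by
  have h := sum_mul_signed_minor_eq_zero
    (Matrix.of fun (r' : Fin n) (c' : Fin (n+1)) =>
      (X 0 : MvPolynomial (Fin 2) R) * C (a r' c') - X 1 * C (b r' c')) r
  have h2 := congrArg (fun f => formCoeff f m j) h
  rw [← sub_eq_zero, ← Finset.sum_sub_distrib]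
  simp only [formCoeff, coeff_sum, coeff_zero] at h2 ⊢
  rw [← h2]
  refine Finset.sum_congr rfl fun c _ => ?_
  rw [← coeff_C_mul, ← coeff_C_mul, ← coeff_C_mul, ← coeff_C_mul, ← coeff_sub]
  congr 1
  simp only [of_apply, map_pow, map_neg, map_one]
  have : (Matrix.of fun (r' : Fin n) (c' : Fin (n+1)) =>
      (X 0 : MvPolynomial (Fin 2) R) * C (a r' c') - X 1 * C (b r' c')).submatrix id c.succAbove =
      Matrix.of fun r' c' : Fin n =>
          (X 0 : MvPolynomial (Fin 2) R) * C (a r' (c.succAbove c')) -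
          X 1 * C (b r' (c.succAbove c')) := rfl
  rw [this]
  ring

lemma mul_pencilMinors_zero (a b : Matrix (Fin n) (Fin (n+1)) R) (r : Fin n) :
    (a * pencilMinors a b) r 0 = 0 := by
  have h := pencil_relation a b r (n+1) 0
  simp only [formCoeff_X_zero_mul _ _ _ (Nat.zero_le _), formCoeff_X_one_mul_zero, mul_zero,
    Finset.sum_const_zero] at h
  exact h

lemma mul_pencilMinors_last (a b : Matrix (Fin n) (Fin (n+1)) R) (r : Fin n) :
    (b * pencilMinors a b) r (Fin.last n) = 0 := by
  have h := pencil_relation a b r (n+1) (n+1)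
  simp only [formCoeff_X_zero_mul_top, formCoeff_X_one_mul, mul_zero,
    Finset.sum_const_zero] at h
  exact h.symm

lemma mul_pencilMinors_succ (a b : Matrix (Fin n) (Fin (n+1)) R) (r j : Fin n) :
    (a * pencilMinors a b) r j.succ = (b * pencilMinors a b) r j.castSucc := by
  have h := pencil_relation a b r (n+1) (j+1)
  simp only [formCoeff_X_zero_mul _ _ _ (show (j : ℕ) + 1 ≤ n by omega), formCoeff_X_one_mul] at h
  exact h

lemma coeff_single_eq_coeff_aeval (s : Fin 2) (m : ℕ) (f : MvPolynomial (Fin 2) R) :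
    coeff (Finsupp.single s m) f =
      (aeval (Pi.single s Polynomial.X : Fin 2 → Polynomial R) f).coeff m := by
  induction f using MvPolynomial.induction_on' with
  | add p q hp hq => simp [hp, hq]
  | monomial d x =>
    rw [aeval_monomial, coeff_monomial, Finsupp.prod_fintype _ _ (by simp), Fin.prod_univ_two,
      Polynomial.algebraMap_eq, Polynomial.coeff_C_mul]
    have hd : d = Finsupp.single s m ↔ d 0 = Finsupp.single s m 0 ∧ d 1 = Finsupp.single s m 1 := by
      rw [DFunLike.ext_iff, Fin.forall_fin_two]
    rw [if_congr hd rfl rfl]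
    fin_cases s
    · rcases eq_or_ne (d 1) 0 with h | h
      · simp [h, Polynomial.coeff_X_pow, eq_comm]
      · simp [h]
    · rcases eq_or_ne (d 0) 0 with h | h
      · simp [h, Polynomial.coeff_X_pow, eq_comm]
      · simp [h]

lemma coeff_det_X_mul (A : Matrix (Fin n) (Fin n) R) :
    (det (Matrix.of fun r c => Polynomial.X * Polynomial.C (A r c))).coeff n = det A := by
  have : (Matrix.of fun r c => Polynomial.X * Polynomial.C (A r c)) =
      (Polynomial.X : Polynomial R) • (Polynomial.C.mapMatrix A) := by
    ext1 r c; simp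
  rw [this, det_smul, ← RingHom.map_det, Fintype.card_fin, Polynomial.coeff_mul_C]
  simp

lemma formCoeff_det_zero (A B : Matrix (Fin n) (Fin n) R) :
    formCoeff (det (Matrix.of fun r c =>
      (X 0 : MvPolynomial (Fin 2) R) * C (A r c) - X 1 * C (B r c))) n 0 = det A := by
  unfold formCoeff
  rw [Finsupp.single_zero, add_zero, Nat.sub_zero, coeff_single_eq_coeff_aeval, AlgHom.map_det,
    ← coeff_det_X_mul A]
  refine congrArg (fun M : Matrix (Fin n) (Fin n) (Polynomial R) => (det M).coeff n) ?_
  ext1 r c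
  simp

lemma formCoeff_det_top (A B : Matrix (Fin n) (Fin n) R) :
    formCoeff (det (Matrix.of fun r c =>
      (X 0 : MvPolynomial (Fin 2) R) * C (A r c) - X 1 * C (B r c))) n n = (-1) ^ n * det B := by
  unfold formCoeff
  have h : (-1) ^ n * det B = det (-B) := by rw [det_neg, Fintype.card_fin]
  rw [Nat.sub_self, Finsupp.single_zero, zero_add, coeff_single_eq_coeff_aeval, AlgHom.map_det,
    h, ← coeff_det_X_mul (-B)]
  refine congrArg (fun M : Matrix (Fin n) (Fin n) (Polynomial R) => (det M).coeff n) ?_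
  ext1 r c
  simp

lemma pencilMinors_apply_zero (a b : Matrix (Fin n) (Fin (n+1)) R) (i : Fin (n+1)) :
    pencilMinors a b i 0 = (-1) ^ (i : ℕ) * det (a.submatrix id i.succAbove) := by
  rw [← formCoeff_det_zero _ (b.submatrix id i.succAbove)]
  rfl

lemma pencilMinors_last_last (a b : Matrix (Fin n) (Fin (n+1)) R) :
    pencilMinors a b (Fin.last n) (Fin.last n) = det (b.submatrix id Fin.castSucc) := by
  have h := formCoeff_det_top (a.submatrix id Fin.castSucc) (b.submatrix id Fin.castSucc)
  simp only [pencilMinors, of_apply, Fin.val_last, Fin.succAbove_last]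
  simp only [submatrix_apply, id] at h
  rw [h, ← mul_assoc, ← mul_pow]
  simp

/-- The matrix whose columns are the common values `b v_j = a v_{j+1}`, where `v_j` are the columns
of `pencilMinors a b`. -/
noncomputable def pencilImage (a b : Matrix (Fin n) (Fin (n+1)) R) : Matrix (Fin n) (Fin n) R :=
  (b * pencilMinors a b).submatrix id Fin.castSucc

lemma left_mul_pencilMinors (a b : Matrix (Fin n) (Fin (n+1)) R) :
    a * pencilMinors a b =
      pencilImage a b * (1 : Matrix (Fin (n+1)) (Fin (n+1)) R).submatrix Fin.succ id := by
  ext r c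
  rw [mul_apply (M := pencilImage a b)]
  refine Fin.cases ?_ (fun j => ?_) c
  · simp [mul_pencilMinors_zero, one_apply]
  · simp [mul_pencilMinors_succ, one_apply, pencilImage]

lemma right_mul_pencilMinors (a b : Matrix (Fin n) (Fin (n+1)) R) :
    b * pencilMinors a b =
      pencilImage a b * (1 : Matrix (Fin (n+1)) (Fin (n+1)) R).submatrix Fin.castSucc id := by
  ext r c
  rw [mul_apply (M := pencilImage a b)]
  refine Fin.lastCases ?_ (fun j => ?_) c
  · simp [mul_pencilMinors_last, one_apply, Fin.castSucc_ne_last]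
  · simp [one_apply, pencilImage]

/-- A matrix `κ` commuting with both shift structures of the standard pencil is scalar. -/
lemma eq_smul_one_of_shift_commute (G : Matrix (Fin n) (Fin n) R)
    (κ : Matrix (Fin (n+1)) (Fin (n+1)) R)
    (h₀ : G * (1 : Matrix (Fin (n+1)) (Fin (n+1)) R).submatrix Fin.succ id =
      (1 : Matrix (Fin (n+1)) (Fin (n+1)) R).submatrix Fin.succ id * κ)
    (h₁ : G * (1 : Matrix (Fin (n+1)) (Fin (n+1)) R).submatrix Fin.castSucc id =
      (1 : Matrix (Fin (n+1)) (Fin (n+1)) R).submatrix Fin.castSucc id * κ) :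
    κ = κ 0 0 • 1 ∧ G = κ 0 0 • 1 := by
  have e₀ : ∀ i c, (G * (1 : Matrix (Fin (n+1)) (Fin (n+1)) R).submatrix Fin.succ id) i c =
      κ i.succ c := by
    intro i c; rw [h₀]; simp [mul_apply, one_apply]
  have e₁ : ∀ i c, (G * (1 : Matrix (Fin (n+1)) (Fin (n+1)) R).submatrix Fin.castSucc id) i c =
      κ i.castSucc c := by
    intro i c; rw [h₁]; simp [mul_apply, one_apply]
  have z₀ : ∀ i, κ (Fin.succ i) 0 = 0 := by
    intro i; rw [← e₀]; simp [mul_apply, one_apply]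
  have z₁ : ∀ i, κ (Fin.castSucc i) (Fin.last n) = 0 := by
    intro i; rw [← e₁]; simp [mul_apply, one_apply, Fin.castSucc_ne_last]
  have s₀ : ∀ i j, κ (Fin.succ i) (Fin.succ j) = G i j := by
    intro i j; rw [← e₀]; simp [mul_apply, one_apply]
  have s₁ : ∀ i j, κ (Fin.castSucc i) (Fin.castSucc j) = G i j := by
    intro i j; rw [← e₁]; simp [mul_apply, one_apply]
  have diag : ∀ i, κ i i = κ 0 0 := by
    intro i
    induction i using Fin.induction with
    | zero => rfl
    | succ i ih => rw [s₀, ← s₁, ih]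
  have low : ∀ j i : Fin (n+1), j < i → κ i j = 0 := by
    intro j
    induction j using Fin.induction with
    | zero =>
      intro i hi
      obtain ⟨i, rfl⟩ := Fin.exists_succ_eq.mpr hi.ne'
      exact z₀ i
    | succ j ih =>
      intro i hi
      obtain ⟨i, rfl⟩ := Fin.exists_succ_eq.mpr (Fin.ne_zero_of_lt hi)
      rw [s₀, ← s₁]
      exact ih _ (by simpa using hi)
  have up : ∀ j i : Fin (n+1), i < j → κ i j = 0 := by
    intro j
    induction j using Fin.reverseInduction with
    | last =>
      intro i hi
      obtain ⟨i, rfl⟩ := Fin.exists_castSucc_eq.mpr hi.ne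
      exact z₁ i
    | cast j ih =>
      intro i hi
      obtain ⟨i, rfl⟩ := Fin.exists_castSucc_eq.mpr (Fin.ne_last_of_lt hi)
      rw [s₁, ← s₀]
      exact ih _ (by simpa using hi)
  have hκ : κ = κ 0 0 • 1 := by
    ext i j
    rcases lt_trichotomy i j with h | h | h
    · simp [up _ _ h, one_apply, h.ne]
    · subst h; simp [diag]
    · simp [low _ _ h, one_apply, h.ne']
  refine ⟨hκ, ?_⟩
  ext i j
  rw [← s₁, hκ]
  simp [one_apply]

/-- Determinant of a matrix vanishing above the antidiagonal. -/
lemma det_of_antitriangular (M : Matrix (Fin n) (Fin n) R)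
    (h : ∀ r c : Fin n, (r : ℕ) + c + 1 < n → M r c = 0) :
    det M = (Equiv.Perm.sign (Fin.revPerm (n := n)) : R) * ∏ r, M r r.rev := by
  have ht : (M.submatrix id (Fin.revPerm (n := n))).BlockTriangular OrderDual.toDual := by
    intro r c hrc
    have hrc' : r < c := hrc
    apply h
    simp [Fin.val_rev]
    omega
  have h1 := det_permute' (Fin.revPerm (n := n)) M
  rw [det_of_isLowerTriangular _ ht] at h1
  simp only [submatrix_apply, id, Fin.revPerm_apply] at h1
  rw [h1, ← mul_assoc, ← Int.cast_mul, ← Units.val_mul, Int.units_mul_self]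
  simp

end CommRing

section Triangular

variable {F : Type*} [Field F] {n : ℕ} {a b : Matrix (Fin n) (Fin (n+1)) F}

lemma det_submatrix_succ_of_antitriangular
    (ha : ∀ (r : Fin n) (c : Fin (n+1)), (r : ℕ) + c < n → a r c = 0) :
    det (a.submatrix id Fin.succ) =
      (Equiv.Perm.sign (Fin.revPerm (n := n)) : F) * ∏ r : Fin n, a r r.rev.succ := by
  rw [det_of_antitriangular]
  · rfl
  · intro r c h
    exact ha _ _ (by simp; omega)

lemma antidiagonal_ne_zero (hdet : det (a.submatrix id Fin.succ) ≠ 0)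
    (ha : ∀ (r : Fin n) (c : Fin (n+1)), (r : ℕ) + c < n → a r c = 0) (r : Fin n) :
    a r r.rev.succ ≠ 0 := by
  rw [det_submatrix_succ_of_antitriangular ha] at hdet
  exact Finset.prod_ne_zero_iff.mp (right_ne_zero_of_mul hdet) r (Finset.mem_univ _)

lemma apply_eq_zero_of_mulVec (hα : ∀ r : Fin n, a r r.rev.succ ≠ 0)
    (ha : ∀ (r : Fin n) (c : Fin (n+1)), (r : ℕ) + c < n → a r c = 0)
    (z : Fin (n+1) → F) (j : ℕ) (hz : ∀ r : Fin n, (r : ℕ) + j < n → (a *ᵥ z) r = 0) :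
    ∀ i : Fin (n+1), j < i → z i = 0 := by
  suffices h : ∀ r : ℕ, ∀ i : Fin (n+1), (i : ℕ) + r = n → j < i → z i = 0 from
    fun i hi => h (n - i) i (by omega) hi
  intro r
  induction r using Nat.strong_induction_on with
  | _ r ih =>
    intro i hir hj
    have hr : r < n := by omega
    have h0 := hz ⟨r, hr⟩ (by simp; omega)
    have hi : (⟨r, hr⟩ : Fin n).rev.succ = i := by
      ext; simp [Fin.val_rev]; omega
    rw [mulVec, dotProduct, Finset.sum_eq_single i] at h0
    · have h1 := hα ⟨r, hr⟩
      rw [hi] at h1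
      exact (mul_eq_zero.mp h0).resolve_left h1
    · intro c _ hc
      rcases lt_or_gt_of_ne (fun h => hc (Fin.ext h) : (c : ℕ) ≠ i) with h | h
      · rw [ha _ _ (by simp; omega), zero_mul]
      · rw [ih (n - c) (by omega) c (by omega) (by omega), mul_zero]
    · simp

lemma pencilMinors_apply_of_lt (hα : ∀ r : Fin n, a r r.rev.succ ≠ 0)
    (ha : ∀ (r : Fin n) (c : Fin (n+1)), (r : ℕ) + c < n → a r c = 0)
    (hb : ∀ (r : Fin n) (c : Fin (n+1)), (r : ℕ) + c + 1 < n → b r c = 0)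
    (j : Fin (n+1)) : ∀ i : Fin (n+1), j < i → pencilMinors a b i j = 0 := by
  induction j using Fin.induction with
  | zero =>
    exact apply_eq_zero_of_mulVec hα ha (fun i => pencilMinors a b i 0) 0
      fun r _ => mul_pencilMinors_zero a b r
  | succ j ih =>
    refine apply_eq_zero_of_mulVec hα ha (fun i => pencilMinors a b i j.succ) (j + 1)
      fun r hr => (mul_pencilMinors_succ a b r j).trans ?_
    rw [mul_apply]
    refine Finset.sum_eq_zero fun c _ => ?_
    rcases lt_or_ge j.castSucc c with h | h
    · rw [ih _ h, mul_zero]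
    · have : (c : ℕ) ≤ j := h
      rw [hb _ _ (by omega), zero_mul]

lemma det_pencilImage (hP : (pencilMinors a b).BlockTriangular id) :
    det (pencilImage a b) = det (pencilMinors a b) := by
  have h : pencilImage a b = b.submatrix id Fin.castSucc *
      (pencilMinors a b).submatrix Fin.castSucc Fin.castSucc := by
    ext r j
    simp only [pencilImage, submatrix_apply, mul_apply, id]
    rw [Fin.sum_univ_castSucc, show pencilMinors a b (Fin.last n) j.castSucc = 0 from
      hP (Fin.castSucc_lt_last j), mul_zero, add_zero]
  have hP' : ((pencilMinors a b).submatrix Fin.castSucc Fin.castSucc).BlockTriangular id :=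
    fun i j hij => hP (Fin.castSucc_lt_castSucc_iff.mpr hij)
  rw [h, det_mul, det_of_isUpperTriangular hP, det_of_isUpperTriangular hP', Fin.prod_univ_castSucc,
    pencilMinors_last_last, mul_comm]
  rfl

lemma pencilImage_apply_of_lt (hP : (pencilMinors a b).BlockTriangular id)
    (hb : ∀ (r : Fin n) (c : Fin (n+1)), (r : ℕ) + c + 1 < n → b r c = 0) (r j : Fin n)
    (h : (r : ℕ) + j + 1 < n) : pencilImage a b r j = 0 := by
  rw [pencilImage, submatrix_apply, mul_apply]
  refine Finset.sum_eq_zero fun c _ => ?_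
  rcases lt_or_ge j.castSucc c with h | h
  · rw [show pencilMinors a b c j.castSucc = 0 from hP h, mul_zero]
  · have : (c : ℕ) ≤ j := h
    rw [id, hb _ _ (by omega), zero_mul]

lemma antidiagonal_ne_zero_of_det_pencilMinors (hdet : det (pencilMinors a b) ≠ 0)
    (ha : ∀ (r : Fin n) (c : Fin (n+1)), (r : ℕ) + c < n → a r c = 0) (r : Fin n) :
    a r r.rev.succ ≠ 0 := by
  refine antidiagonal_ne_zero (fun h => hdet ?_) ha r
  refine det_eq_zero_of_column_eq_zero 0 fun i => ?_
  rw [pencilMinors_apply_zero]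
  rcases eq_or_ne i 0 with rfl | hi
  · rw [Fin.succAbove_zero, h, mul_zero]
  · have hn : 0 < n := r.pos
    rw [det_eq_zero_of_column_eq_zero ⟨0, hn⟩, mul_zero]
    intro s
    refine ha _ _ ?_
    rw [Fin.succAbove_of_castSucc_lt]
    · simp
    · exact Fin.pos_iff_ne_zero.mpr hi

lemma pencilMinors_blockTriangular (hdet : det (pencilMinors a b) ≠ 0)
    (ha : ∀ (r : Fin n) (c : Fin (n+1)), (r : ℕ) + c < n → a r c = 0)
    (hb : ∀ (r : Fin n) (c : Fin (n+1)), (r : ℕ) + c + 1 < n → b r c = 0) :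
    (pencilMinors a b).BlockTriangular id := fun i j hij =>
  pencilMinors_apply_of_lt (antidiagonal_ne_zero_of_det_pencilMinors hdet ha) ha hb j i hij

/-- Pencils of the same triangular shape and the same nonzero `λ`-invariant are equivalent under
lower triangular matrices of determinant one. -/
lemma exists_lowerTriangular_equiv {a' b' : Matrix (Fin n) (Fin (n+1)) F}
    (hdet : det (pencilMinors a b) ≠ 0)
    (hdet' : det (pencilMinors a' b') = det (pencilMinors a b))
    (ha : ∀ (r : Fin n) (c : Fin (n+1)), (r : ℕ) + c < n → a r c = 0)
    (hb : ∀ (r : Fin n) (c : Fin (n+1)), (r : ℕ) + c + 1 < n → b r c = 0)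
    (ha' : ∀ (r : Fin n) (c : Fin (n+1)), (r : ℕ) + c < n → a' r c = 0)
    (hb' : ∀ (r : Fin n) (c : Fin (n+1)), (r : ℕ) + c + 1 < n → b' r c = 0) :
    ∃ (g : Matrix (Fin n) (Fin n) F) (h : Matrix (Fin (n+1)) (Fin (n+1)) F),
      det g = 1 ∧ det h = 1 ∧ (∀ i j, i < j → g i j = 0) ∧ (∀ i j, i < j → h i j = 0) ∧
      g * a * hᵀ = a' ∧ g * b * hᵀ = b' := by
  have hdet'' : det (pencilMinors a' b') ≠ 0 := hdet' ▸ hdet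
  have hP := pencilMinors_blockTriangular hdet ha hb
  have hP' := pencilMinors_blockTriangular hdet'' ha' hb'
  have hU := det_pencilImage hP
  have hU' := det_pencilImage hP'
  have uP' : IsUnit (det (pencilMinors a' b')) := hdet''.isUnit
  have uU : IsUnit (det (pencilImage a b)) := by rw [hU]; exact hdet.isUnit
  have tU := pencilImage_apply_of_lt hP hb
  have tU' := pencilImage_apply_of_lt hP' hb'
  have l₀ := left_mul_pencilMinors a b
  have l₁ := right_mul_pencilMinors a b
  have l₀' := left_mul_pencilMinors a' b'
  have l₁' := right_mul_pencilMinors a' b'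
  generalize pencilMinors a b = P at *
  generalize pencilMinors a' b' = P' at *
  generalize pencilImage a b = U at *
  generalize pencilImage a' b' = U' at *
  have reversed : ∀ V : Matrix (Fin n) (Fin n) F,
      (∀ r j : Fin n, (r : ℕ) + j + 1 < n → V r j = 0) →
      (V.submatrix id (Fin.revPerm (n := n))).BlockTriangular OrderDual.toDual := by
    intro V hV i j hij
    have hij' : i < j := hij
    exact hV _ _ (by simp [Fin.val_rev]; omega)
  refine ⟨U' * U⁻¹, (P * P'⁻¹)ᵀ, ?_, ?_, ?_, ?_, ?_, ?_⟩
  · rw [det_mul, det_nonsing_inv, hU', hdet', ← hU, Ring.mul_inverse_cancel _ uU]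
  · rw [det_transpose, det_mul, det_nonsing_inv, ← hdet', Ring.mul_inverse_cancel _ uP']
  · have uR : IsUnit (det (U.submatrix id (Fin.revPerm (n := n)))) := by
      rw [det_permute']
      exact (((Equiv.Perm.sign _).isUnit.map (Int.castRingHom F))).mul uU
    let _ := invertibleOfIsUnitDet _ uR
    have h := (reversed U' tU').mul (blockTriangular_inv_of_blockTriangular (reversed U tU))
    have e := inv_submatrix_equiv U (Equiv.refl _) (Fin.revPerm (n := n))
    rw [Equiv.coe_refl] at e
    rw [e, submatrix_mul_equiv] at h
    intro i j hij
    exact h (show OrderDual.toDual j < OrderDual.toDual i from hij)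
  · let _ := invertibleOfIsUnitDet _ uP'
    intro i j hij
    exact (hP.mul (blockTriangular_inv_of_blockTriangular hP')) hij
  · rw [transpose_transpose, Matrix.mul_assoc, Matrix.mul_assoc, ← Matrix.mul_assoc a, l₀,
      ← Matrix.mul_assoc U⁻¹, ← Matrix.mul_assoc U⁻¹, nonsing_inv_mul _ uU, Matrix.one_mul,
      ← Matrix.mul_assoc, ← l₀', mul_nonsing_inv_cancel_right _ _ uP']
  · rw [transpose_transpose, Matrix.mul_assoc, Matrix.mul_assoc, ← Matrix.mul_assoc b, l₁,
      ← Matrix.mul_assoc U⁻¹, ← Matrix.mul_assoc U⁻¹, nonsing_inv_mul _ uU, Matrix.one_mul,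
      ← Matrix.mul_assoc, ← l₁', mul_nonsing_inv_cancel_right _ _ uP']

/-- A pair of determinant-one matrices fixing a nondegenerate pencil is trivial. -/
lemma eq_one_of_fixes_pencil (hdet : det (pencilMinors a b) ≠ 0)
    (ha : ∀ (r : Fin n) (c : Fin (n+1)), (r : ℕ) + c < n → a r c = 0)
    (hb : ∀ (r : Fin n) (c : Fin (n+1)), (r : ℕ) + c + 1 < n → b r c = 0)
    {g : Matrix (Fin n) (Fin n) F} {h : Matrix (Fin (n+1)) (Fin (n+1)) F}
    (hg : det g = 1) (hh : det h = 1) (hga : g * a * hᵀ = a) (hgb : g * b * hᵀ = b) :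
    g = 1 ∧ h = 1 := by
  have hU := det_pencilImage (pencilMinors_blockTriangular hdet ha hb)
  have uP : IsUnit (det (pencilMinors a b)) := hdet.isUnit
  have uU : IsUnit (det (pencilImage a b)) := by rw [hU]; exact uP
  have uh : IsUnit (det hᵀ) := by rw [det_transpose, hh]; exact isUnit_one
  have l₀ := left_mul_pencilMinors a b
  have l₁ := right_mul_pencilMinors a b
  generalize pencilMinors a b = P at *
  generalize pencilImage a b = U at *
  have key : ∀ (m E : Matrix (Fin n) (Fin (n+1)) F), g * m * hᵀ = m → m * P = U * E →
      (U⁻¹ * g * U) * E = E * (P⁻¹ * hᵀ⁻¹ * P) := by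
    intro m E h1 h2
    have hE : E = U⁻¹ * m * P := by
      rw [Matrix.mul_assoc, h2, nonsing_inv_mul_cancel_left _ _ uU]
    have h3 : g * m = m * hᵀ⁻¹ := by
      conv_rhs => rw [← h1]
      rw [mul_nonsing_inv_cancel_right _ _ uh]
    calc (U⁻¹ * g * U) * E = U⁻¹ * g * (U * E) := by simp only [Matrix.mul_assoc]
      _ = U⁻¹ * (g * m) * P := by rw [← h2]; simp only [Matrix.mul_assoc]
      _ = U⁻¹ * m * (P * P⁻¹) * hᵀ⁻¹ * P := by
        rw [h3, mul_nonsing_inv _ uP]; simp only [Matrix.mul_assoc, Matrix.one_mul]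
      _ = E * (P⁻¹ * hᵀ⁻¹ * P) := by rw [hE]; simp only [Matrix.mul_assoc]
  obtain ⟨hκ, hG⟩ := eq_smul_one_of_shift_commute _ _ (key a _ hga l₀) (key b _ hgb l₁)
  set c := (P⁻¹ * hᵀ⁻¹ * P) 0 0
  have hκ' : hᵀ⁻¹ = c • 1 := by
    have h1 : P * (P⁻¹ * hᵀ⁻¹ * P) * P⁻¹ = hᵀ⁻¹ := by
      rw [Matrix.mul_assoc P⁻¹, mul_nonsing_inv_cancel_left _ _ uP,
        mul_nonsing_inv_cancel_right _ _ uP]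
    rw [← h1, hκ, Matrix.mul_smul, Matrix.smul_mul, Matrix.mul_one, mul_nonsing_inv _ uP]
  have hG' : g = c • 1 := by
    have h1 : U * (U⁻¹ * g * U) * U⁻¹ = g := by
      rw [Matrix.mul_assoc U⁻¹, mul_nonsing_inv_cancel_left _ _ uU,
        mul_nonsing_inv_cancel_right _ _ uU]
    rw [← h1, hG, Matrix.mul_smul, Matrix.smul_mul, Matrix.mul_one, mul_nonsing_inv _ uU]
  have c₁ : c ^ n = 1 := by
    have := hg
    rw [hG', det_smul, det_one, mul_one, Fintype.card_fin] at this
    exact this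
  have c₂ : c ^ (n + 1) = 1 := by
    have h1 := congrArg det hκ'
    rw [det_nonsing_inv, det_transpose, hh, Ring.inverse_one, det_smul, det_one, mul_one,
      Fintype.card_fin] at h1
    exact h1.symm
  have hc : c = 1 := by rw [pow_succ, c₁, one_mul] at c₂; exact c₂
  rw [hc, one_smul] at hκ' hG'
  refine ⟨hG', ?_⟩
  have h1 := nonsing_inv_nonsing_inv _ uh
  rw [hκ', inv_one] at h1
  exact transpose_eq_one.mp h1.symm

/-- Every value of the `λ`-invariant is attained on pencils of triangular shape. -/
lemma exists_pencil_of_lambda (hn : 1 ≤ n) (Q : F) :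
    ∃ a b : Matrix (Fin n) (Fin (n+1)) F,
      (∀ (r : Fin n) (c : Fin (n+1)), (r : ℕ) + c < n → a r c = 0) ∧
      (∀ (r : Fin n) (c : Fin (n+1)), (r : ℕ) + c + 1 < n → b r c = 0) ∧
      det (pencilMinors a b) = Q := by
  obtain ⟨m, rfl⟩ : ∃ m, n = m + 1 := ⟨n - 1, by omega⟩
  let a : Matrix (Fin (m+1)) (Fin (m+1+1)) F :=
    Matrix.of fun r c => if (r : ℕ) + c = m + 1 then 1 else 0
  have ha : ∀ (r : Fin (m+1)) (c : Fin (m+1+1)), (r : ℕ) + c < m + 1 → a r c = 0 :=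
    fun r c h => if_neg h.ne
  have hα : ∀ r : Fin (m+1), a r r.rev.succ = 1 :=
    fun r => if_pos (by simp [Fin.val_rev]; omega)
  have hs : det (a.submatrix id Fin.succ) ≠ 0 := by
    rw [det_submatrix_succ_of_antitriangular ha]
    simp only [hα, Finset.prod_const_one, mul_one]
    exact ((Equiv.Perm.sign _).isUnit.map (Int.castRingHom F)).ne_zero
  set s := det (a.submatrix id Fin.succ) with s_def
  let q : F := Q / s ^ (m + 2)
  let b : Matrix (Fin (m+1)) (Fin (m+1+1)) F :=
    Matrix.of fun r c => if (r : ℕ) + c = m then (if r = 0 then q else 1) else 0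
  have hb : ∀ (r : Fin (m+1)) (c : Fin (m+1+1)), (r : ℕ) + c + 1 < m + 1 → b r c = 0 :=
    fun r c h => if_neg (by omega)
  have hP : ∀ j i, j < i → pencilMinors a b i j = 0 :=
    pencilMinors_apply_of_lt (fun r => by rw [hα]; exact one_ne_zero) ha hb
  have step : ∀ j : Fin (m+1), pencilMinors a b j.succ j.succ =
      (if j.rev = 0 then q else 1) * pencilMinors a b j.castSucc j.castSucc := by
    intro j
    have h := mul_pencilMinors_succ a b j.rev j
    rw [mul_apply, mul_apply, Finset.sum_eq_single j.succ, Finset.sum_eq_single j.castSucc] at h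
    · have h1 : a j.rev j.succ = 1 := by simpa using hα j.rev
      have h2 : b j.rev j.castSucc = if j.rev = 0 then q else 1 :=
        if_pos (by simp [Fin.val_rev]; omega)
      rwa [h1, h2, one_mul] at h
    · intro c _ hc
      have hne : (j.rev : ℕ) + c ≠ m := fun h => hc (Fin.ext (by
        simp [Fin.val_rev] at h ⊢; omega))
      rw [show b j.rev c = 0 from if_neg hne, zero_mul]
    · simp
    · intro c _ hc
      have hne : (j.rev : ℕ) + c ≠ m + 1 := fun h => hc (Fin.ext (by
        simp [Fin.val_rev] at h ⊢; omega))
      rw [show a j.rev c = 0 from if_neg hne, zero_mul]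
    · simp
  have p₀ : pencilMinors a b 0 0 = s := by
    rw [pencilMinors_apply_zero, Fin.succAbove_zero]
    simp [s_def]
  have diag : ∀ j : Fin (m+1), pencilMinors a b j.castSucc j.castSucc = s := by
    intro j
    induction j using Fin.induction with
    | zero => exact p₀
    | succ j ih =>
      rw [← Fin.succ_castSucc, step, ih, if_neg, one_mul]
      intro h
      have := congrArg Fin.val h
      simp [Fin.val_rev] at this
      omega
  have last : pencilMinors a b (Fin.last (m+1)) (Fin.last (m+1)) = q * s := by
    rw [← Fin.succ_last, step, diag, if_pos (Fin.rev_last m)]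
  refine ⟨a, b, ha, hb, ?_⟩
  rw [det_of_isUpperTriangular (fun i j hij => hP j i hij), Fin.prod_univ_castSucc, last]
  simp only [diag, Finset.prod_const, Finset.card_univ, Fintype.card_fin, q]
  field_simp
  ring

end Triangular

section Blocks

variable {R : Type*} {n : ℕ}

/-- The identification of `Fin n ⊕ Fin (n+1)` with `Fin (2n+1)` given by `rowIdx` and `colIdx`. -/
def blockEquiv (n : ℕ) : Fin n ⊕ Fin (n+1) ≃ Fin (2*n+1) :=
  finSumFinEquiv.trans (finCongr (by omega))

@[simp] lemma blockEquiv_inl (i : Fin n) : blockEquiv n (Sum.inl i) = rowIdx n i := rfl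

@[simp] lemma blockEquiv_inr (i : Fin (n+1)) : blockEquiv n (Sum.inr i) = colIdx n i := rfl

@[simp] lemma val_rowIdx (i : Fin n) : (rowIdx n i : ℕ) = i := rfl

@[simp] lemma val_colIdx (i : Fin (n+1)) : (colIdx n i : ℕ) = n + i := rfl

/-- The top-right `n × (n+1)` block. -/
def topRight (M : Matrix (Fin (2*n+1)) (Fin (2*n+1)) R) : Matrix (Fin n) (Fin (n+1)) R :=
  M.submatrix (rowIdx n) (colIdx n)

/-- The matrix with given blocks. -/
def ofBlocks (A : Matrix (Fin n) (Fin n) R) (B : Matrix (Fin n) (Fin (n+1)) R)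
    (C : Matrix (Fin (n+1)) (Fin n) R) (D : Matrix (Fin (n+1)) (Fin (n+1)) R) :
    Matrix (Fin (2*n+1)) (Fin (2*n+1)) R :=
  (fromBlocks A B C D).submatrix (blockEquiv n).symm (blockEquiv n).symm

lemma forall_blockIdx {p : Fin (2*n+1) → Prop} :
    (∀ i, p i) ↔ (∀ i, p (rowIdx n i)) ∧ ∀ i, p (colIdx n i) := by
  rw [← (blockEquiv n).forall_congr_right, Sum.forall]
  rfl

section

variable (A : Matrix (Fin n) (Fin n) R) (B : Matrix (Fin n) (Fin (n+1)) R)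
  (C : Matrix (Fin (n+1)) (Fin n) R) (D : Matrix (Fin (n+1)) (Fin (n+1)) R)

@[simp] lemma ofBlocks_row_row (i j) : ofBlocks A B C D (rowIdx n i) (rowIdx n j) = A i j := by
  simp [ofBlocks, ← blockEquiv_inl]

@[simp] lemma ofBlocks_row_col (i j) : ofBlocks A B C D (rowIdx n i) (colIdx n j) = B i j := by
  simp [ofBlocks, ← blockEquiv_inl, ← blockEquiv_inr]

@[simp] lemma ofBlocks_col_row (i j) : ofBlocks A B C D (colIdx n i) (rowIdx n j) = C i j := by
  simp [ofBlocks, ← blockEquiv_inl, ← blockEquiv_inr]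

@[simp] lemma ofBlocks_col_col (i j) : ofBlocks A B C D (colIdx n i) (colIdx n j) = D i j := by
  simp [ofBlocks, ← blockEquiv_inr]

@[simp] lemma topRight_ofBlocks : topRight (ofBlocks A B C D) = B := by
  ext i j; simp [topRight]

end

lemma ext_blockIdx {M M' : Matrix (Fin (2*n+1)) (Fin (2*n+1)) R}
    (h₁ : ∀ i j, M (rowIdx n i) (rowIdx n j) = M' (rowIdx n i) (rowIdx n j))
    (h₂ : ∀ i j, M (rowIdx n i) (colIdx n j) = M' (rowIdx n i) (colIdx n j))
    (h₃ : ∀ i j, M (colIdx n i) (rowIdx n j) = M' (colIdx n i) (rowIdx n j))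
    (h₄ : ∀ i j, M (colIdx n i) (colIdx n j) = M' (colIdx n i) (colIdx n j)) : M = M' := by
  have : ∀ i j, M i j = M' i j :=
    forall_blockIdx.mpr ⟨fun i => forall_blockIdx.mpr ⟨h₁ i, h₂ i⟩,
      fun i => forall_blockIdx.mpr ⟨h₃ i, h₄ i⟩⟩
  exact Matrix.ext this

variable [CommRing R]

/-- The congruence action of block-diagonal matrices on symmetric matrices with zero diagonal
blocks. -/
lemma ofBlocks_congr_act (g : Matrix (Fin n) (Fin n) R) (h : Matrix (Fin (n+1)) (Fin (n+1)) R)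
    (a : Matrix (Fin n) (Fin (n+1)) R) :
    ofBlocks g 0 0 h * ofBlocks 0 a aᵀ 0 * (ofBlocks g 0 0 h)ᵀ =
      ofBlocks 0 (g * a * hᵀ) (g * a * hᵀ)ᵀ 0 := by
  simp only [ofBlocks, transpose_submatrix, fromBlocks_transpose, submatrix_mul_equiv,
    fromBlocks_multiply]
  simp [Matrix.mul_assoc]

lemma eq_ofBlocks_topRight {M : Matrix (Fin (2*n+1)) (Fin (2*n+1)) R} (hs : M.IsSymm)
    (h : ∀ i j : Fin (2*n+1), (((i : ℕ) < n ∧ (j : ℕ) < n) ∨ (n ≤ (i : ℕ) ∧ n ≤ (j : ℕ))) →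
      M i j = 0) : M = ofBlocks 0 (topRight M) (topRight M)ᵀ 0 := by
  apply ext_blockIdx <;> intro i j
  · rw [h _ _ (by simp)]; simp
  · simp [topRight]
  · rw [hs.apply]; simp [topRight]
  · rw [h _ _ (by simp)]; simp

lemma lambdaInv_eq (w : MPair n R) :
    lambdaInv n w = det (pencilMinors (topRight w.1) (topRight w.2)) := rfl

lemma Wtop0mem.fst_eq {w : MPair n R} (hw : Wtop0mem n w) :
    w.1 = ofBlocks 0 (topRight w.1) (topRight w.1)ᵀ 0 :=
  eq_ofBlocks_topRight hw.1.1.1 fun i j h => (hw.1.2 i j h).1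

lemma Wtop0mem.snd_eq {w : MPair n R} (hw : Wtop0mem n w) :
    w.2 = ofBlocks 0 (topRight w.2) (topRight w.2)ᵀ 0 :=
  eq_ofBlocks_topRight hw.1.1.2 fun i j h => (hw.1.2 i j h).2

lemma Wtop0mem.topRight_fst {w : MPair n R} (hw : Wtop0mem n w) (r : Fin n) (c : Fin (n+1))
    (h : (r : ℕ) + c < n) : topRight w.1 r c = 0 :=
  (hw.2 _ _).1 (by simp; omega)

lemma Wtop0mem.topRight_snd {w : MPair n R} (hw : Wtop0mem n w) (r : Fin n) (c : Fin (n+1))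
    (h : (r : ℕ) + c + 1 < n) : topRight w.2 r c = 0 :=
  (hw.2 _ _).2 (by simp; omega)

lemma wtop0mem_ofBlocks {a b : Matrix (Fin n) (Fin (n+1)) R}
    (ha : ∀ (r : Fin n) (c : Fin (n+1)), (r : ℕ) + c < n → a r c = 0)
    (hb : ∀ (r : Fin n) (c : Fin (n+1)), (r : ℕ) + c + 1 < n → b r c = 0) :
    Wtop0mem n (ofBlocks 0 a aᵀ 0, ofBlocks 0 b bᵀ 0) := by
  have symm : ∀ m : Matrix (Fin n) (Fin (n+1)) R, (ofBlocks 0 m mᵀ 0).IsSymm := by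
    intro m
    apply ext_blockIdx <;> intro i j <;> simp
  refine ⟨⟨⟨symm a, symm b⟩, ?_⟩, ?_⟩
  · simp only [forall_blockIdx]
    refine ⟨fun i => ⟨fun j => ?_, fun j => ?_⟩, fun i => ⟨fun j => ?_, fun j => ?_⟩⟩ <;> simp
  · simp only [forall_blockIdx]
    refine ⟨fun i => ⟨fun j => ?_, fun j => ?_⟩, fun i => ⟨fun j => ?_, fun j => ?_⟩⟩
    · simp
    · simp only [ofBlocks_row_col, val_rowIdx, val_colIdx]
      exact ⟨fun h => ha _ _ (by omega), fun h => hb _ _ (by omega)⟩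
    · simp only [ofBlocks_col_row, val_rowIdx, val_colIdx, transpose_apply]
      exact ⟨fun h => ha _ _ (by omega), fun h => hb _ _ (by omega)⟩
    · simp

lemma lnmem_ofBlocks {g : Matrix (Fin n) (Fin n) R} {h : Matrix (Fin (n+1)) (Fin (n+1)) R}
    (hg : det g = 1) (hh : det h = 1) (tg : ∀ i j, i < j → g i j = 0)
    (th : ∀ i j, i < j → h i j = 0) : LNmem n (ofBlocks g 0 0 h) := by
  refine ⟨⟨?_, ?_, ?_⟩, ?_⟩
  · simp only [forall_blockIdx]
    refine ⟨fun i => ⟨fun j => ?_, fun j => ?_⟩, fun i => ⟨fun j => ?_, fun j => ?_⟩⟩ <;> simp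
  · simp only [ofBlocks_row_row]
    exact hg
  · simp only [ofBlocks_col_col]
    exact hh
  · simp only [forall_blockIdx]
    refine ⟨fun i => ⟨fun j => ?_, fun j => ?_⟩, fun i => ⟨fun j => ?_, fun j => ?_⟩⟩
    · simpa using tg i j
    · simp
    · simp
    · simpa using th i j

lemma SLnn1mem.eq_ofBlocks {g : Matrix (Fin (2*n+1)) (Fin (2*n+1)) R} (hg : SLnn1mem n g) :
    g = ofBlocks (Matrix.of fun i j => g (rowIdx n i) (rowIdx n j)) 0 0
      (Matrix.of fun i j => g (colIdx n i) (colIdx n j)) := by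
  apply ext_blockIdx <;> intro i j
  · simp
  · rw [hg.1 _ _ (by simp)]; simp
  · rw [hg.1 _ _ (by simp)]; simp
  · simp

lemma ofBlocks_one : ofBlocks (1 : Matrix (Fin n) (Fin n) R) 0 0 1 = 1 := by
  rw [ofBlocks, fromBlocks_one, submatrix_one_equiv]

end Blocks

/-- **Transitivity of `L_N(K)` on `λ`-level sets of `W_N^{top,0}(K)`.**
For every subfield `K ⊆ ℂ` and `Q₀ ∈ K^×`, the set
`{(A,B) ∈ W_N^{top,0}(K) : λ(A,B) = Q₀}` is nonempty, `L_N(K)` acts transitively on it,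
and all stabilizers are trivial. -/
theorem LN_transitive_on_lambda_level_sets (n : ℕ) (hn : 1 ≤ n) (K : Subfield ℂ)
    (Q₀ : K) (hQ₀ : Q₀ ≠ 0) :
    (∃ w : MPair n K, Wtop0mem n w ∧ lambdaInv n w = Q₀) ∧
    (∀ w w' : MPair n K, Wtop0mem n w → Wtop0mem n w' →
        lambdaInv n w = Q₀ → lambdaInv n w' = Q₀ →
        ∃ g : Matrix (Fin (2*n+1)) (Fin (2*n+1)) K, LNmem n g ∧ actPair g w = w') ∧
    (∀ (g : Matrix (Fin (2*n+1)) (Fin (2*n+1)) K) (w : MPair n K),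
        LNmem n g → Wtop0mem n w → lambdaInv n w = Q₀ → actPair g w = w → g = 1) := by
  refine ⟨?_, ?_, ?_⟩
  · obtain ⟨a, b, ha, hb, hdet⟩ := exists_pencil_of_lambda hn Q₀
    refine ⟨_, wtop0mem_ofBlocks ha hb, ?_⟩
    rw [lambdaInv_eq, topRight_ofBlocks, topRight_ofBlocks, hdet]
  · intro w w' hw hw' hl hl'
    rw [lambdaInv_eq] at hl hl'
    obtain ⟨g, h, hg, hh, tg, th, e₁, e₂⟩ := exists_lowerTriangular_equiv (hl ▸ hQ₀)
      (hl'.trans hl.symm) hw.topRight_fst hw.topRight_snd hw'.topRight_fst hw'.topRight_snd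
    refine ⟨ofBlocks g 0 0 h, lnmem_ofBlocks hg hh tg th, Prod.ext ?_ ?_⟩
    · rw [actPair, hw.fst_eq, ofBlocks_congr_act, e₁, ← hw'.fst_eq]
    · rw [actPair, hw.snd_eq, ofBlocks_congr_act, e₂, ← hw'.snd_eq]
  · intro g w hg hw hl hfix
    rw [lambdaInv_eq] at hl
    have hgb := hg.1.eq_ofBlocks
    have e₁ := congrArg (fun v : MPair n K => topRight v.1) hfix
    have e₂ := congrArg (fun v : MPair n K => topRight v.2) hfix
    simp only [actPair] at e₁ e₂
    rw [hgb, hw.fst_eq, ofBlocks_congr_act, topRight_ofBlocks, topRight_ofBlocks] at e₁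
    rw [hgb, hw.snd_eq, ofBlocks_congr_act, topRight_ofBlocks, topRight_ofBlocks] at e₂
    obtain ⟨h₁, h₂⟩ := eq_one_of_fixes_pencil (hl ▸ hQ₀) hw.topRight_fst hw.topRight_snd
      hg.1.2.1 hg.1.2.2 e₁ e₂
    rw [hgb, h₁, h₂, ofBlocks_one]
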